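/- Fix μ ∈ (0,1), p ∈ (1/2,1), a moderate price τ (β_l < τ < β_h), and a threshold ratio q ∈ (0,1]. For each n let σ*_n be the unique symmetric non-trivial Bayes–Nash equilibrium of the crowdfunding game with parameters (n, μ, p, ⌈q·n⌉, τ) (which exists for all sufficiently large n and satisfies σ*_n(h) = 1). Then the low-signal mixing probabilities converge: lim_{n→∞} σ*_n(l) = 0 if q ≤ 1−p, and lim_{n→∞} σ*_n(l) = (q−(1−p))/p if q > 1−p. -/

import Mathlib

open Finset Filter

/-- Upper tail of the binomial distribution: `P(Bin(m, r) ≥ k)`. -/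
noncomputable def binTail (m k : ℕ) (r : ℝ) : ℝ :=
  ∑ j ∈ Finset.Icc k m, (m.choose j : ℝ) * r ^ j * (1 - r) ^ (m - j)

/-- Contribution probability conditional on the high-value state `G`. -/
noncomputable def rG (p σh σl : ℝ) : ℝ := p * σh + (1 - p) * σl

/-- Contribution probability conditional on the low-value state `B`. -/
noncomputable def rB (p σh σl : ℝ) : ℝ := (1 - p) * σh + p * σl

/-- Posterior probability of state `G` after the high signal `h`. -/
noncomputable def postH (μ p : ℝ) : ℝ := μ * p / (μ * p + (1 - μ) * (1 - p))

/-- Posterior probability of state `G` after the low signal `l`. -/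
noncomputable def postL (μ p : ℝ) : ℝ := μ * (1 - p) / (μ * (1 - p) + (1 - μ) * p)

/-- Expected gain from contributing for an agent whose posterior on `G` is `β`,
when each of the other `n - 1` agents plays the symmetric strategy `(σh, σl)`
and the threshold is `T`. -/
noncomputable def gain (n T : ℕ) (p τ β σh σl : ℝ) : ℝ :=
  β * (1 - τ) * binTail (n - 1) (T - 1) (rG p σh σl)
    - (1 - β) * τ * binTail (n - 1) (T - 1) (rB p σh σl)

/-- `(σh, σl)` is a symmetric Bayes–Nash equilibrium of the crowdfunding game
with parameters `(n, μ, p, T, τ)`. -/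
def IsSymmEq (n T : ℕ) (μ p τ σh σl : ℝ) : Prop :=
  0 ≤ σh ∧ σh ≤ 1 ∧ 0 ≤ σl ∧ σl ≤ 1 ∧
  (0 < σh → 0 ≤ gain n T p τ (postH μ p) σh σl) ∧
  (σh < 1 → gain n T p τ (postH μ p) σh σl ≤ 0) ∧
  (0 < σl → 0 ≤ gain n T p τ (postL μ p) σh σl) ∧
  (σl < 1 → gain n T p τ (postL μ p) σh σl ≤ 0)

theorem binTail_nonneg (m k : ℕ) {r : ℝ} (h0 : 0 ≤ r) (h1 : r ≤ 1) : 0 ≤ binTail m k r := by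
  have := sub_nonneg.2 h1
  unfold binTail
  positivity

theorem binTail_pos {m k : ℕ} (hk : k ≤ m) {r : ℝ} (h0 : 0 < r) (h1 : r ≤ 1) :
    0 < binTail m k r := by
  have := sub_nonneg.2 h1
  exact Finset.sum_pos' (fun j _ => by positivity) ⟨m, by simp [hk], by simp [h0]⟩

theorem binTail_antitone (m : ℕ) {r : ℝ} (h0 : 0 ≤ r) (h1 : r ≤ 1) :
    Antitone fun k => binTail m k r := by
  intro k l hkl
  have := sub_nonneg.2 h1
  exact Finset.sum_le_sum_of_subset_of_nonneg (Finset.Icc_subset_Icc_left hkl)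
    fun j _ _ => by positivity

theorem binTail_zero_right (m : ℕ) (r : ℝ) : binTail m 0 r = 1 := by
  have h := add_pow r (1 - r) m
  rw [add_sub_cancel, one_pow] at h
  rw [h, binTail, ← Nat.range_succ_eq_Icc_zero]
  exact Finset.sum_congr rfl fun j _ => by ring

theorem binTail_le_one (m k : ℕ) {r : ℝ} (h0 : 0 ≤ r) (h1 : r ≤ 1) : binTail m k r ≤ 1 :=
  (binTail_antitone m h0 h1 (Nat.zero_le k)).trans_eq (binTail_zero_right m r)

theorem binTail_add_binTail_reflect {m k : ℕ} (hk : k ≤ m + 1) (r : ℝ) :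
    binTail m k r + binTail m (m + 1 - k) (1 - r) = 1 := by
  have hreflect : binTail m (m + 1 - k) (1 - r) =
      ∑ j ∈ Finset.range k, (m.choose j : ℝ) * r ^ j * (1 - r) ^ (m - j) := by
    unfold binTail
    refine Finset.sum_nbij' (fun j => m - j) (fun j => m - j) ?_ ?_ ?_ ?_ ?_
    · intro j hj; simp only [Finset.mem_Icc, Finset.mem_range] at *; omega
    · intro j hj; simp only [Finset.mem_Icc, Finset.mem_range] at *; omega
    · intro j hj; simp only [Finset.mem_Icc] at *; omega
    · intro j hj; simp only [Finset.mem_range] at *; omega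
    · intro j hj
      have hjm := (Finset.mem_Icc.1 hj).2
      rw [Nat.choose_symm hjm, Nat.sub_sub_self hjm, sub_sub_cancel]
      ring
  refine Eq.trans ?_ (binTail_zero_right m r)
  rw [hreflect, binTail, binTail, add_comm]
  have hIcc (a : ℕ) : Finset.Icc a m = Finset.Ico a (m + 1) := by ext; simp
  rw [hIcc, hIcc, Finset.range_eq_Ico]
  exact Finset.sum_Ico_consecutive _ (Nat.zero_le k) hk

theorem binTail_succ_succ (m k : ℕ) (r : ℝ) :
    binTail (m + 1) (k + 1) r = r * binTail m k r + (1 - r) * binTail m (k + 1) r := by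
  have hshift (f : ℕ → ℝ) :
      ∑ j ∈ Finset.Icc (k + 1) (m + 1), f j = ∑ j ∈ Finset.Icc k m, f (j + 1) := by
    rw [← Finset.map_add_right_Icc k m 1, Finset.sum_map]
    rfl
  have hlast : (1 - r) * binTail m (k + 1) r =
      ∑ j ∈ Finset.Icc (k + 1) (m + 1), (m.choose j : ℝ) * r ^ j * (1 - r) ^ (m + 1 - j) := by
    rw [binTail, Finset.mul_sum]
    refine (Finset.sum_congr rfl fun j hj => ?_).trans
      (Finset.sum_subset (Finset.Icc_subset_Icc_right m.le_succ) fun j hj hj' => ?_)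
    · rw [Nat.succ_sub (Finset.mem_Icc.1 hj).2, pow_succ]
      ring
    · rw [Nat.choose_eq_zero_of_lt (by simp only [Finset.mem_Icc] at *; omega)]
      simp
  rw [hlast, hshift, binTail, hshift, binTail, Finset.mul_sum, ← Finset.sum_add_distrib]
  refine Finset.sum_congr rfl fun j _ => ?_
  rw [Nat.choose_succ_succ, Nat.add_sub_add_right]
  push_cast
  ring

theorem binTail_mono (m k : ℕ) {r s : ℝ} (h0 : 0 ≤ r) (hrs : r ≤ s) (h1 : s ≤ 1) :
    binTail m k r ≤ binTail m k s := by
  induction m generalizing k with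
  | zero =>
    cases k with
    | zero => simp [binTail_zero_right]
    | succ k => simp [binTail]
  | succ m ih =>
    cases k with
    | zero => simp [binTail_zero_right]
    | succ k =>
      have hanti := binTail_antitone m h0 (hrs.trans h1) k.le_succ
      simp only [Nat.succ_eq_add_one] at hanti
      rw [binTail_succ_succ, binTail_succ_succ]
      have h2 := mul_le_mul_of_nonneg_left (ih k) (h0.trans hrs)
      have h3 := mul_le_mul_of_nonneg_left (ih (k + 1)) (sub_nonneg.2 h1)
      nlinarith [mul_nonneg (sub_nonneg.2 hrs) (sub_nonneg.2 hanti)]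

/-- A Chernoff-type comparison of two binomial tails above the larger mean. -/
theorem binTail_le_exp_mul_binTail {m k : ℕ} {a b : ℝ} (ha : 0 ≤ a) (hab : a ≤ b) (hb0 : 0 < b)
    (hb1 : b < 1) (hk : m * b ≤ k) :
    binTail m k a ≤ Real.exp ((b - a) * (m * b - k)) * binTail m k b := by
  have h1b : 0 < 1 - b := sub_pos.2 hb1
  have h1a : 0 ≤ 1 - a := by linarith
  have hsucc : a ≤ b * Real.exp (-((b - a) / b)) := by
    have := mul_le_mul_of_nonneg_left (Real.add_one_le_exp (-((b - a) / b))) hb0.le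
    refine le_trans (le_of_eq ?_) this
    field_simp
    ring
  have hfail : 1 - a ≤ (1 - b) * Real.exp ((b - a) / (1 - b)) := by
    have := mul_le_mul_of_nonneg_left (Real.add_one_le_exp ((b - a) / (1 - b))) h1b.le
    refine le_trans (le_of_eq ?_) this
    field_simp
    ring
  rw [binTail, binTail, Finset.mul_sum]
  refine Finset.sum_le_sum fun j hj => ?_
  obtain ⟨hkj, hjm⟩ := Finset.mem_Icc.1 hj
  have hexp : (j : ℝ) * -((b - a) / b) + (m - j : ℕ) * ((b - a) / (1 - b)) ≤
      (b - a) * (m * b - k) := by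
    rw [Nat.cast_sub hjm]
    have hkj' : (k : ℝ) ≤ j := by exact_mod_cast hkj
    have heq : (j : ℝ) * -((b - a) / b) + (m - j) * ((b - a) / (1 - b)) =
        (b - a) * (m * b - j) / (b * (1 - b)) := by
      field_simp
      ring
    rw [heq, div_le_iff₀ (by positivity)]
    have h1 : (b - a) * (m * b - j) ≤ (b - a) * (m * b - k) :=
      mul_le_mul_of_nonneg_left (by linarith) (sub_nonneg.2 hab)
    have h2 : (b - a) * (m * b - k) ≤ 0 :=
      mul_nonpos_of_nonneg_of_nonpos (sub_nonneg.2 hab) (by linarith)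
    nlinarith [sq_nonneg (1 - b), sq_nonneg b]
  calc (m.choose j : ℝ) * a ^ j * (1 - a) ^ (m - j)
      ≤ (m.choose j : ℝ) * (b * Real.exp (-((b - a) / b))) ^ j *
          ((1 - b) * Real.exp ((b - a) / (1 - b))) ^ (m - j) := by gcongr
    _ = Real.exp ((j : ℝ) * -((b - a) / b) + (m - j : ℕ) * ((b - a) / (1 - b))) *
          ((m.choose j : ℝ) * b ^ j * (1 - b) ^ (m - j)) := by
        rw [Real.exp_add, Real.exp_nat_mul, Real.exp_nat_mul, mul_pow, mul_pow]
        ring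
    _ ≤ _ := by gcongr

/-- A binomial with success probability bounded above `q` reaches `⌈q n⌉ - 1` with probability
exponentially close to one. -/
theorem one_sub_exp_le_binTail {n : ℕ} {q r δ : ℝ} (hn : 1 ≤ n) (hq : 0 < q) (hq1 : q ≤ 1)
    (hδ : 0 < δ) (hr : q + 2 * δ ≤ r) (hr1 : r ≤ 1) :
    1 - Real.exp (-(δ ^ 2 * (n - 1 : ℕ))) ≤ binTail (n - 1) (⌈q * (n : ℝ)⌉₊ - 1) r := by
  set T := ⌈q * (n : ℝ)⌉₊
  have hn' : (1 : ℝ) ≤ n := by exact_mod_cast hn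
  have hT1 : 1 ≤ T := Nat.one_le_iff_ne_zero.2 (Nat.ceil_pos.2 (by positivity)).ne'
  have hTn : T ≤ n := Nat.ceil_le.2 (by nlinarith)
  have hTlt : (T : ℝ) < q * n + 1 := Nat.ceil_lt_add_one (by positivity)
  have hsum := binTail_add_binTail_reflect (m := n - 1) (k := T - 1) (by omega) r
  have hk : ((n - 1 + 1 - (T - 1) : ℕ) : ℝ) = n - T + 1 := by
    have : n - 1 + 1 - (T - 1) + T = n + 1 := by omega
    have : ((n - 1 + 1 - (T - 1) : ℕ) : ℝ) + T = n + 1 := by exact_mod_cast this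
    linarith
  have hm : ((n - 1 : ℕ) : ℝ) = n - 1 := by simp [Nat.cast_sub hn]
  have hgap : ((n - 1 : ℕ) : ℝ) * (1 - q - δ) - (n - 1 + 1 - (T - 1) : ℕ) ≤
      -(δ * (n - 1 : ℕ)) := by
    rw [hk, hm]
    nlinarith
  have hδm : 0 ≤ δ * (n - 1 : ℕ) := by positivity
  have hle := binTail_le_exp_mul_binTail (m := n - 1) (k := n - 1 + 1 - (T - 1))
    (a := 1 - r) (b := 1 - q - δ) (by linarith) (by linarith) (by linarith) (by linarith)
    (by linarith)
  have htail := binTail_le_one (n - 1) (n - 1 + 1 - (T - 1)) (r := 1 - q - δ)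
    (by linarith) (by linarith)
  have hexp : Real.exp ((1 - q - δ - (1 - r)) *
      ((n - 1 : ℕ) * (1 - q - δ) - (n - 1 + 1 - (T - 1) : ℕ))) ≤
      Real.exp (-(δ ^ 2 * (n - 1 : ℕ))) := by
    apply Real.exp_le_exp.2
    nlinarith
  have := hle.trans (mul_le_of_le_one_right (Real.exp_pos _).le htail)
  linarith

/-- When the smaller success probability is bounded below `q`, the ratio of the probabilities of
reaching `⌈q n⌉ - 1` decays exponentially. -/
theorem binTail_le_exp_mul_binTail_ceil {n : ℕ} {q a b δ c : ℝ} (hn : 1 ≤ n) (hq1 : q ≤ 1)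
    (ha : 0 ≤ a) (hb1 : b ≤ 1) (hc : 0 < c) (hcδ : c ≤ δ) (haq : a + 2 * δ ≤ q) (hab : a + c ≤ b)
    (hδn : 1 ≤ δ * (n - 1 : ℕ)) :
    binTail (n - 1) (⌈q * (n : ℝ)⌉₊ - 1) a ≤
      Real.exp (c * (1 - δ * (n - 1 : ℕ))) * binTail (n - 1) (⌈q * (n : ℝ)⌉₊ - 1) b := by
  set T := ⌈q * (n : ℝ)⌉₊
  have hn' : (1 : ℝ) ≤ n := by exact_mod_cast hn
  have hq : 0 < q := by linarith
  have hT1 : 1 ≤ T := Nat.one_le_iff_ne_zero.2 (Nat.ceil_pos.2 (by positivity)).ne'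
  have hTge : q * n ≤ T := Nat.le_ceil _
  have hm : ((n - 1 : ℕ) : ℝ) = n - 1 := by simp [Nat.cast_sub hn]
  have hk : ((T - 1 : ℕ) : ℝ) = T - 1 := by simp [Nat.cast_sub hT1]
  set b' := min b (q - δ)
  have hb'b : b' ≤ b := min_le_left _ _
  have hb'q : b' ≤ q - δ := min_le_right _ _
  have hab' : a + c ≤ b' := le_min hab (by linarith)
  have hgap : ((n - 1 : ℕ) : ℝ) * b' - (T - 1 : ℕ) ≤ 1 - δ * (n - 1 : ℕ) := by
    have := mul_le_mul_of_nonneg_left hb'q (Nat.cast_nonneg (α := ℝ) (n - 1))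
    rw [hm] at this ⊢
    rw [hk]
    nlinarith
  have hle := binTail_le_exp_mul_binTail (m := n - 1) (k := T - 1) (a := a) (b := b')
    ha (by linarith) (by linarith) (by linarith) (by linarith)
  refine hle.trans (mul_le_mul (Real.exp_le_exp.2 ?_) (binTail_mono _ _ (by linarith) hb'b hb1)
    (binTail_nonneg _ _ (by linarith) (by linarith)) (Real.exp_pos _).le)
  nlinarith

theorem tendsto_exp_mul_sub_mul_natCast {c δ : ℝ} (d : ℝ) (hc : 0 < c) (hδ : 0 < δ) :
    Tendsto (fun n : ℕ => Real.exp (c * (d - δ * (n - 1 : ℕ)))) atTop (nhds 0) := by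
  refine Real.tendsto_exp_atBot.comp (Tendsto.const_mul_atBot hc ?_)
  refine tendsto_const_nhds.add_atBot (f := fun _ => d) (g := fun n : ℕ => -(δ * (n - 1 : ℕ))) ?_
    |>.congr fun n => by ring
  exact tendsto_neg_atTop_atBot.comp
    ((tendsto_natCast_atTop_atTop.comp (tendsto_sub_atTop_nat 1)).const_mul_atTop hδ)

theorem postL_pos {μ p : ℝ} (hμ : 0 < μ ∧ μ < 1) (hp : 0 < p ∧ p < 1) : 0 < postL μ p := by
  have h1 : 0 < 1 - μ := by linarith
  have h2 : 0 < 1 - p := by linarith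
  have := hμ.1
  have := hp.1
  unfold postL
  positivity

theorem postH_lt_one {μ p : ℝ} (hμ : 0 < μ ∧ μ < 1) (hp : 0 < p ∧ p < 1) : postH μ p < 1 := by
  have h1 : 0 < (1 - μ) * (1 - p) := mul_pos (by linarith) (by linarith)
  have h2 : 0 < μ * p := mul_pos hμ.1 hp.1
  rw [postH, div_lt_one (by linarith)]
  linarith

/-- The low-signal agent strictly prefers to abstain when the good is funded almost surely
in state `B`. -/
theorem eventually_gain_neg {p q τ β x₀ : ℝ} (hp : 0 < p ∧ p < 1) (hq : 0 < q ∧ q ≤ 1)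
    (hβ : 0 < β) (hβτ : β < τ) (hτ : τ < 1) (hx₀ : q < rB p 1 x₀) :
    ∀ᶠ n : ℕ in atTop, ∀ x, x₀ ≤ x → 0 ≤ x → x ≤ 1 →
      gain n ⌈q * (n : ℝ)⌉₊ p τ β 1 x < 0 := by
  unfold rB at hx₀
  obtain ⟨δ, hδ, hδq⟩ : ∃ δ > 0, q + 2 * δ = (1 - p) * 1 + p * x₀ :=
    ⟨((1 - p) * 1 + p * x₀ - q) / 2, by linarith, by ring⟩
  have hc : 0 < (1 - β) * τ := mul_pos (by linarith) (by linarith)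
  have hlim : Tendsto (fun n : ℕ => (1 - β) * τ * Real.exp (δ * (0 - δ * (n - 1 : ℕ))))
      atTop (nhds 0) := by
    simpa using (tendsto_exp_mul_sub_mul_natCast 0 hδ hδ).const_mul ((1 - β) * τ)
  filter_upwards [hlim.eventually_lt_const (sub_pos.2 hβτ), eventually_ge_atTop 1]
    with n hn hn1 x hx h0 h1
  have hr : q + 2 * δ ≤ rB p 1 x := by
    rw [hδq, rB]
    nlinarith [mul_le_mul_of_nonneg_left hx hp.1.le]
  have hB := one_sub_exp_le_binTail hn1 hq.1 hq.2 hδ hr (by unfold rB; nlinarith)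
  have hG := binTail_le_one (n - 1) (⌈q * (n : ℝ)⌉₊ - 1) (r := rG p 1 x)
    (by unfold rG; nlinarith) (by unfold rG; nlinarith)
  rw [show δ * (0 - δ * ((n - 1 : ℕ) : ℝ)) = -(δ ^ 2 * (n - 1 : ℕ)) by ring] at hn
  have h2 := mul_le_mul_of_nonneg_left hB hc.le
  have h3 := mul_le_mul_of_nonneg_left hG (mul_pos hβ (sub_pos.2 hτ)).le
  unfold gain
  linarith

/-- An agent with positive posterior strictly prefers to contribute when funding in state `B` is
exponentially less likely than in state `G`. -/
theorem eventually_gain_pos {p q τ β x₀ : ℝ} (hp : 1 / 2 < p ∧ p < 1) (hq : q ≤ 1)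
    (hβ : 0 < β) (hβ1 : β < 1) (hτ0 : 0 < τ) (hτ : τ < 1) (hx₀ : rB p 1 x₀ < q) :
    ∀ᶠ n : ℕ in atTop, ∀ x, x ≤ x₀ → 0 ≤ x →
      0 < gain n ⌈q * (n : ℝ)⌉₊ p τ β 1 x := by
  unfold rB at hx₀
  have hx₀1 : x₀ < 1 := by nlinarith
  obtain ⟨δ, hδ, hδq⟩ : ∃ δ > 0, (1 - p) * 1 + p * x₀ + 2 * δ = q :=
    ⟨(q - ((1 - p) * 1 + p * x₀)) / 2, by linarith, by ring⟩
  obtain ⟨c, hc, hcδ, hcx⟩ : ∃ c > 0, c ≤ δ ∧ c ≤ (2 * p - 1) * (1 - x₀) :=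
    ⟨min δ ((2 * p - 1) * (1 - x₀)), lt_min hδ (mul_pos (by linarith) (by linarith)),
      min_le_left _ _, min_le_right _ _⟩
  have hlim : Tendsto (fun n : ℕ => (1 - β) * τ * Real.exp (c * (1 - δ * (n - 1 : ℕ))))
      atTop (nhds 0) := by
    simpa using (tendsto_exp_mul_sub_mul_natCast 1 hc hδ).const_mul ((1 - β) * τ)
  have hβτ : 0 < β * (1 - τ) := mul_pos hβ (sub_pos.2 hτ)
  have hlarge : ∀ᶠ n : ℕ in atTop, 1 ≤ δ * (n - 1 : ℕ) :=
    ((tendsto_natCast_atTop_atTop.comp (tendsto_sub_atTop_nat 1)).const_mul_atTop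
      hδ).eventually_ge_atTop 1
  filter_upwards [hlim.eventually_lt_const hβτ, hlarge, eventually_ge_atTop 1]
    with n hn hδn hn1 x hx h0
  have hpx := mul_le_mul_of_nonneg_left hx (by linarith : 0 ≤ p)
  have hB0 : 0 ≤ rB p 1 x := by unfold rB; nlinarith
  have hG1 : rG p 1 x ≤ 1 := by unfold rG; nlinarith
  have hG0 : 0 < rG p 1 x := by unfold rG; nlinarith
  have hle := binTail_le_exp_mul_binTail_ceil hn1 hq hB0 hG1 hc hcδ
    (by unfold rB; linarith) (by unfold rB rG; nlinarith) hδn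
  have hTn : ⌈q * (n : ℝ)⌉₊ ≤ n := Nat.ceil_le.2 (mul_le_of_le_one_left n.cast_nonneg hq)
  have hG := binTail_pos (Nat.sub_le_sub_right hTn 1) hG0 hG1
  have h2 := mul_le_mul_of_nonneg_left hle (mul_pos (sub_pos.2 hβ1) hτ0).le
  have h3 := mul_lt_mul_of_pos_right hn hG
  unfold gain
  linarith

/-- AKS Lemma 1: with a moderate price and threshold ratio `q`, the
low-signal mixing probability of the unique symmetric non-trivial equilibrium converges,
as `n → ∞`, to `0` if `q ≤ 1 - p` and to `(q - (1 - p)) / p` otherwise. -/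
theorem limit_of_low_signal_mixing_probability
    (μ p τ q : ℝ)
    (hμ : 0 < μ ∧ μ < 1) (hp : 1 / 2 < p ∧ p < 1)
    (hmod : postL μ p < τ ∧ τ < postH μ p)
    (hq : 0 < q ∧ q ≤ 1)
    (σ : ℕ → ℝ × ℝ)
    (hσ : ∀ᶠ n in atTop,
      (IsSymmEq n ⌈q * (n : ℝ)⌉₊ μ p τ (σ n).1 (σ n).2 ∧ (0 < (σ n).1 ∨ 0 < (σ n).2)) ∧
      (∀ σ' : ℝ × ℝ,
        (IsSymmEq n ⌈q * (n : ℝ)⌉₊ μ p τ σ'.1 σ'.2 ∧ (0 < σ'.1 ∨ 0 < σ'.2)) → σ' = σ n) ∧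
      (σ n).1 = 1) :
    Tendsto (fun n => (σ n).2) atTop
      (nhds (if q ≤ 1 - p then 0 else (q - (1 - p)) / p)) := by
  have hp' : 0 < p ∧ p < 1 := ⟨by linarith, hp.2⟩
  have hβ := postL_pos hμ hp'
  have hτ1 : τ < 1 := hmod.2.trans (postH_lt_one hμ hp')
  set X : ℝ := if q ≤ 1 - p then 0 else (q - (1 - p)) / p with hX
  have hX0 : 0 ≤ X := by
    rw [hX]
    split_ifs with h
    · exact le_rfl
    · exact div_nonneg (by linarith) hp'.1.le
  have hqX : q ≤ (1 - p) + p * X := by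
    rw [hX]
    split_ifs with h
    · linarith
    · rw [mul_div_cancel₀ _ hp'.1.ne']
      linarith
  refine tendsto_order.2 ⟨fun x₀ hx₀ => ?_, fun x₀ hx₀ => ?_⟩
  · rcases lt_or_ge x₀ 0 with hneg | hnonneg
    · filter_upwards [hσ] with n hn
      exact hneg.trans_le hn.1.1.2.2.1
    have hpX : (1 - p) + p * X = q := by
      by_cases h : q ≤ 1 - p
      · rw [hX, if_pos h] at hx₀
        linarith
      · rw [hX, if_neg h, mul_div_cancel₀ _ hp'.1.ne']
        ring
    have hBx₀ : rB p 1 x₀ < q := by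
      unfold rB
      nlinarith [mul_lt_mul_of_pos_left hx₀ hp'.1]
    have hx₀1 : x₀ < 1 := by
      unfold rB at hBx₀
      nlinarith [hq.2]
    filter_upwards [hσ, eventually_gain_pos hp hq.2 hβ (hmod.1.trans hτ1) (hβ.trans hmod.1) hτ1
      hBx₀] with n hn hgain
    obtain ⟨⟨⟨-, -, h0, -, -, -, -, hle⟩, -⟩, -, hσ1⟩ := hn
    by_contra! hx
    rw [hσ1] at hle
    exact (hgain _ hx h0).not_ge (hle (hx.trans_lt hx₀1))
  · have hBx₀ : q < rB p 1 x₀ := by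
      unfold rB
      nlinarith [mul_lt_mul_of_pos_left hx₀ hp'.1]
    filter_upwards [hσ, eventually_gain_neg hp' hq hβ hmod.1 hτ1 hBx₀] with n hn hgain
    obtain ⟨⟨⟨-, -, h0, h1, -, -, hge, -⟩, -⟩, -, hσ1⟩ := hn
    by_contra! hx
    rw [hσ1] at hge
    exact (hgain _ hx h0 h1).not_ge (hge (hX0.trans_lt (hx₀.trans_le hx)))
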